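/- arXiv:2002.06911 — 2 statements merged into one kernel-verified Lean document; each statement's English description precedes it below -/
import Mathlib

section
/- Persistence of conditional linear term values: let τ be a conditional linear term (a linear term possibly containing conditional expressions) and ⟨h,t⟩ an interpretation. If h(eval_{⟨h,t⟩}(τ)) ≠ u, then eval_{⟨h,t⟩}(τ) = eval_{⟨t,t⟩}(τ) and h(eval_{⟨h,t⟩}(τ)) = t(eval_{⟨t,t⟩}(τ)). -/
/- Formalization of the fragment of HT_C built from linear constraints over
   conditional linear terms, as used for LC-programs.  The domain `D` contains
   the integers (witnessed by an `IntDom` structure); besides linear constraints,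
   formulas may contain abstract condition-free constraint atoms drawn from `A`
   (with an abstract monotonic denotation `den`). -/

universe u v

namespace HTC

/-- Valuations: partial functions from variables `X` to domain values `D`
    (`none` represents the undefined value `u`). -/
def Val (X D : Type) : Type := X → Option D

/-- `v ⊆ v'` : every variable defined in `v` has the same value in `v'`. -/
def Val.le {X D : Type} (v v' : Val X D) : Prop :=
  ∀ (x : X) (d : D), v x = some d → v' x = some d

/-- Formulas over an abstract type of atoms `A`. -/
inductive Fml (A : Type u) : Type u where
  | bot  : Fml A
  | atom : A → Fml A
  | and  : Fml A → Fml A → Fml A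
  | or   : Fml A → Fml A → Fml A
  | imp  : Fml A → Fml A → Fml A

/-- Negation `¬φ := φ → ⊥`. -/
def Fml.neg {A : Type u} (φ : Fml A) : Fml A := φ.imp .bot

/-- Truth `⊤ := ⊥ → ⊥`. -/
def Fml.top {A : Type u} : Fml A := Fml.neg .bot

/-- Denotation condition (1): monotonicity of the abstract condition-free atoms. -/
def Mono {X D A : Type} (den : A → Set (Val X D)) : Prop :=
  ∀ (a : A) (v v' : Val X D), v ∈ den a → Val.le v v' → v' ∈ den a

/-- Witness that the domain `D` contains the integers (`𝒟 ⊇ ℤ`). -/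
structure IntDom (D : Type) : Type where
  emb : ℤ → D
  toInt : D → Option ℤ
  emb_toInt : ∀ n : ℤ, toInt (emb n) = some n
  toInt_emb : ∀ (d : D) (n : ℤ), toInt d = some n → d = emb n

/-- Condition-free linear terms: built from integer constants and variables
    using `+` and `-`. -/
inductive LTerm (X : Type) : Type where
  | const : ℤ → LTerm X
  | var : X → LTerm X
  | add : LTerm X → LTerm X → LTerm X
  | sub : LTerm X → LTerm X → LTerm X

/-- Linear terms possibly mentioning the undefined value `u`: the result of
    evaluating the conditional expressions of a conditional linear term. -/
inductive UTerm (X : Type) : Type where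
  | const : ℤ → UTerm X
  | var : X → UTerm X
  | undef : UTerm X
  | add : UTerm X → UTerm X → UTerm X
  | sub : UTerm X → UTerm X → UTerm X

/-- Embedding of condition-free linear terms. -/
def LTerm.toU {X : Type} : LTerm X → UTerm X
  | .const n => .const n
  | .var x => .var x
  | .add a b => .add a.toU b.toU
  | .sub a b => .sub a.toU b.toU

/-- Evaluation of a term by a valuation `v`: an integer when all variables of the
    term take integer values (and no `u` occurs), undefined (`none`) otherwise. -/
def UTerm.eval {X D : Type} (I : IntDom D) (v : Val X D) : UTerm X → Option ℤ
  | .const n => some n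
  | .var x => (v x).bind I.toInt
  | .undef => none
  | .add a b => (a.eval I v).bind (fun m => (b.eval I v).map (fun n => m + n))
  | .sub a b => (a.eval I v).bind (fun m => (b.eval I v).map (fun n => m - n))

/-- Evaluation of a condition-free linear term. -/
def LTerm.eval {X D : Type} (I : IntDom D) (v : Val X D) (a : LTerm X) : Option ℤ :=
  a.toU.eval I v

/-- Condition-free atoms: abstract constraint atoms from `A`, or linear
    constraints `α ≤ β` between condition-free linear terms. -/
abbrev CFAtom (X A : Type) : Type := A ⊕ (LTerm X × LTerm X)

/-- Condition-free formulas. -/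
abbrev CFml (X A : Type) : Type := Fml (CFAtom X A)

/-- Satisfaction of a condition-free atom by a valuation; a linear constraint
    `α ≤ β` holds iff both terms evaluate to integers `m ≤ n`. -/
def CFAtomSat {X D A : Type} (I : IntDom D) (den : A → Set (Val X D)) (v : Val X D) :
    CFAtom X A → Prop
  | .inl a => v ∈ den a
  | .inr p => ∃ m n : ℤ, p.1.eval I v = some m ∧ p.2.eval I v = some n ∧ m ≤ n

/-- HT satisfaction of condition-free formulas. -/
def SatCF {X D A : Type} (I : IntDom D) (den : A → Set (Val X D)) :
    Val X D → Val X D → CFml X A → Prop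
  | _, _, .bot => False
  | h, _, .atom a => CFAtomSat I den h a
  | h, t, .and φ ψ => SatCF I den h t φ ∧ SatCF I den h t ψ
  | h, t, .or φ ψ => SatCF I den h t φ ∨ SatCF I den h t ψ
  | h, t, .imp φ ψ =>
      (SatCF I den h t φ → SatCF I den h t ψ) ∧ (SatCF I den t t φ → SatCF I den t t ψ)

/-- Conditional linear terms: linear terms whose subterms may be conditional
    expressions `(s | s' : φ)` with `s`, `s'` condition-free linear terms and `φ`
    a condition-free formula. -/
inductive CLTerm (X A : Type) : Type where
  | const : ℤ → CLTerm X A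
  | var : X → CLTerm X A
  | add : CLTerm X A → CLTerm X A → CLTerm X A
  | sub : CLTerm X A → CLTerm X A → CLTerm X A
  | cond : LTerm X → LTerm X → CFml X A → CLTerm X A

open Classical in
/-- `eval⟨h,t⟩(τ)`: replace each conditional expression `(s | s' : φ)` of `τ` by
    `s` if `⟨h,t⟩ ⊨ φ`, by `s'` if `⟨t,t⟩ ⊭ φ`, and by `u` otherwise. -/
noncomputable def CLTerm.reduce {X D A : Type} (I : IntDom D) (den : A → Set (Val X D))
    (h t : Val X D) : CLTerm X A → UTerm X
  | .const n => .const n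
  | .var x => .var x
  | .add a b => .add (a.reduce I den h t) (b.reduce I den h t)
  | .sub a b => .sub (a.reduce I den h t) (b.reduce I den h t)
  | .cond s s' φ =>
      if SatCF I den h t φ then s.toU
      else if ¬ SatCF I den t t φ then s'.toU
      else .undef

/-- Atoms of the LC fragment: abstract condition-free atoms, or linear constraints
    `α ≤ β` between conditional linear terms. -/
abbrev LAtom (X A : Type) : Type := A ⊕ (CLTerm X A × CLTerm X A)

/-- Formulas of the LC fragment. -/
abbrev LFml (X A : Type) : Type := Fml (LAtom X A)

/-- `⟨h,t⟩ ⊨ c` for an atom of the LC fragment: for a (conditional) linear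
    constraint `α ≤ β` this is `h ∈ ⟦eval⟨h,t⟩(α) ≤ eval⟨h,t⟩(β)⟧`. -/
def LAtomSat {X D A : Type} (I : IntDom D) (den : A → Set (Val X D))
    (h t : Val X D) : LAtom X A → Prop
  | .inl a => h ∈ den a
  | .inr p => ∃ m n : ℤ,
      (p.1.reduce I den h t).eval I h = some m ∧
      (p.2.reduce I den h t).eval I h = some n ∧ m ≤ n

/-- HT_C satisfaction for the LC fragment. -/
def SatL {X D A : Type} (I : IntDom D) (den : A → Set (Val X D)) :
    Val X D → Val X D → LFml X A → Prop
  | _, _, .bot => False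
  | h, t, .atom a => LAtomSat I den h t a
  | h, t, .and φ ψ => SatL I den h t φ ∧ SatL I den h t ψ
  | h, t, .or φ ψ => SatL I den h t φ ∨ SatL I den h t ψ
  | h, t, .imp φ ψ =>
      (SatL I den h t φ → SatL I den h t ψ) ∧ (SatL I den t t φ → SatL I den t t ψ)

/-- The linear constraint `α ≤ β` as a formula. -/
def leF {X A : Type} (α β : CLTerm X A) : LFml X A := Fml.atom (Sum.inr (α, β))

/-- `def(α)`: satisfied in `⟨h,t⟩` iff `h(eval⟨h,t⟩(α)) ∈ ℤ` (encoded as `α ≤ α`). -/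
def defF {X A : Type} (α : CLTerm X A) : LFml X A := leF α α

/-- An assignment `x := α..β`. -/
structure Assign (X A : Type) : Type where
  x : X
  lo : CLTerm X A
  hi : CLTerm X A

/-- `def(A) := def(α) ∧ def(β)` for an assignment `A = (x := α..β)`. -/
def Assign.defF {X A : Type} (a : Assign X A) : LFml X A :=
  (HTC.defF a.lo).and (HTC.defF a.hi)

/-- The non-directional version `Φ(A) := (α ≤ x) ∧ (x ≤ β)`. -/
def Assign.phi {X A : Type} (a : Assign X A) : LFml X A :=
  (leF a.lo (CLTerm.var a.x)).and (leF (CLTerm.var a.x) a.hi)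

/-- The assignment `A = (x := α..β)` stands for the formula
    `¬¬def(A) ∧ (def(A) → (α ≤ x) ∧ (x ≤ β))`. -/
def Assign.fml {X A : Type} (a : Assign X A) : LFml X A :=
  (Fml.neg (Fml.neg a.defF)).and (a.defF.imp a.phi)

end HTC

namespace HTC

theorem UTerm.eval_mono {X D : Type} (I : IntDom D) {h t : Val X D} (hht : Val.le h t)
    (a : UTerm X) : ∀ n : ℤ, a.eval I h = some n → a.eval I t = some n := by
  induction a with
  | const m => intro n hn; exact hn
  | undef => intro n hn; exact hn
  | var x =>
    intro n hn
    simp only [UTerm.eval, Option.bind_eq_some_iff] at hn ⊢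
    obtain ⟨d, hd, hn⟩ := hn
    exact ⟨d, hht x d hd, hn⟩
  | add a b iha ihb =>
    intro n hn
    simp only [UTerm.eval, Option.bind_eq_some_iff, Option.map_eq_some_iff] at hn ⊢
    obtain ⟨m, hm, k, hk, e⟩ := hn
    exact ⟨m, iha m hm, k, ihb k hk, e⟩
  | sub a b iha ihb =>
    intro n hn
    simp only [UTerm.eval, Option.bind_eq_some_iff, Option.map_eq_some_iff] at hn ⊢
    obtain ⟨m, hm, k, hk, e⟩ := hn
    exact ⟨m, iha m hm, k, ihb k hk, e⟩

theorem SatCF_persist {X D A : Type} (I : IntDom D) (den : A → Set (Val X D))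
    (h1 : Mono den) {h t : Val X D} (hht : Val.le h t) (φ : CFml X A) :
    SatCF I den h t φ → SatCF I den t t φ := by
  induction φ with
  | bot => exact id
  | atom a =>
    intro hs
    cases a with
    | inl a => exact h1 a h t hs hht
    | inr p =>
      obtain ⟨m, n, hm, hn, hmn⟩ := hs
      exact ⟨m, n, UTerm.eval_mono I hht _ m hm, UTerm.eval_mono I hht _ n hn, hmn⟩
  | and φ ψ i j => exact fun hs => ⟨i hs.1, j hs.2⟩
  | or φ ψ i j => exact fun hs => hs.imp i j
  | imp φ ψ i j => exact fun hs => ⟨hs.2, hs.2⟩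

theorem CLTerm.reduce_eq {X D A : Type} (I : IntDom D) (den : A → Set (Val X D))
    (h1 : Mono den) {h t : Val X D} (hht : Val.le h t) (τ : CLTerm X A) :
    ∀ n : ℤ, (τ.reduce I den h t).eval I h = some n →
      τ.reduce I den h t = τ.reduce I den t t := by
  induction τ with
  | const m => intro n hn; rfl
  | var x => intro n hn; rfl
  | add a b iha ihb =>
    intro n hn
    simp only [CLTerm.reduce, UTerm.eval, Option.bind_eq_some_iff, Option.map_eq_some_iff] at hn ⊢
    obtain ⟨m, hm, k, hk, e⟩ := hn
    rw [iha m hm, ihb k hk]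
  | sub a b iha ihb =>
    intro n hn
    simp only [CLTerm.reduce, UTerm.eval, Option.bind_eq_some_iff, Option.map_eq_some_iff] at hn ⊢
    obtain ⟨m, hm, k, hk, e⟩ := hn
    rw [iha m hm, ihb k hk]
  | cond s s' φ =>
    intro n hn
    by_cases hs : SatCF I den h t φ
    · have ht := SatCF_persist I den h1 hht φ hs
      simp [CLTerm.reduce, hs, ht]
    · by_cases ht : SatCF I den t t φ
      · simp [CLTerm.reduce, hs, ht, UTerm.eval] at hn
      · simp [CLTerm.reduce, hs, ht]

/-- Proposition 2: persistence of conditional linear term values: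
    for a conditional linear term `τ` and an interpretation `⟨h,t⟩`,
    if `h(eval⟨h,t⟩(τ)) ≠ u` then `eval⟨h,t⟩(τ) = eval⟨t,t⟩(τ)` and
    `h(eval⟨h,t⟩(τ)) = t(eval⟨t,t⟩(τ))`. -/
theorem clterm_persistence {X D A : Type} (I : IntDom D) (den : A → Set (Val X D))
    (h1 : Mono den)
    (h t : Val X D) (hht : Val.le h t)
    (τ : CLTerm X A)
    (hdef : (τ.reduce I den h t).eval I h ≠ none) :
    τ.reduce I den h t = τ.reduce I den t t ∧
    (τ.reduce I den h t).eval I h = (τ.reduce I den t t).eval I t := by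
  obtain ⟨n, hn⟩ := Option.ne_none_iff_exists'.mp hdef
  have e := CLTerm.reduce_eq I den h1 hht τ n hn
  refine ⟨e, ?_⟩
  rw [← e, hn, UTerm.eval_mono I hht _ n hn]

end HTC
end

section
/- Unfolding of LC-rules: an LC-rule r of the form A₁ ; … ; Aₙ ← B₁, …, B_m, ¬B_{m+1}, …, ¬B_k is equivalent (has the same HT_C models) to the conjunction, over all subsets Δ ⊆ H(r), of the implications Ψ_Δ: (⋁_{A∈Δ} Φ(A)) ← B(r) ∧ ⋀_{A∈Δ} def(A) ∧ ⋀_{A'∈H(r)∖Δ} ¬Φ(A'). -/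
/- Formalization of the fragment of HT_C built from linear constraints over
   conditional linear terms, as used for LC-programs.  The domain `D` contains
   the integers (witnessed by an `IntDom` structure); besides linear constraints,
   formulas may contain abstract condition-free constraint atoms drawn from `A`
   (with an abstract monotonic denotation `den`). -/

universe u v

namespace HTC

/-- Finite conjunction (empty conjunction is `⊤`). -/
def bigAnd {B : Type u} (l : List (Fml B)) : Fml B := l.foldr Fml.and Fml.top

/-- Finite disjunction (empty disjunction is `⊥`). -/
def bigOr {B : Type u} (l : List (Fml B)) : Fml B := l.foldr Fml.or Fml.bot

/-- An LC-rule `A₁ ; … ; Aₙ ← B₁, …, B_m, ¬B_{m+1}, …, ¬B_k` where each `Aᵢ` is an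
    assignment and each `Bⱼ` a linear constraint. -/
structure LCRule (X A : Type) : Type where
  hn : ℕ
  head : Fin hn → Assign X A
  pos : List (CLTerm X A × CLTerm X A)
  negs : List (CLTerm X A × CLTerm X A)

/-- `B(r)`: the conjunction `B₁ ∧ … ∧ B_m ∧ ¬B_{m+1} ∧ … ∧ ¬B_k`. -/
def LCRule.bodyFml {X A : Type} (r : LCRule X A) : LFml X A :=
  bigAnd (r.pos.map (fun c => Fml.atom (Sum.inr c)) ++
          r.negs.map (fun c => Fml.neg (Fml.atom (Sum.inr c))))

/-- The rule `r` as the formula `B(r) → (A₁ ∨ … ∨ Aₙ)`. -/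
def LCRule.fml {X A : Type} (r : LCRule X A) : LFml X A :=
  r.bodyFml.imp (bigOr ((List.finRange r.hn).map (fun i => (r.head i).fml)))

/-- The implication `Ψ_Δ` for a subset `Δ ⊆ H(r)`:
    `(⋁_{A ∈ Δ} Φ(A)) ← B(r) ∧ ⋀_{A ∈ Δ} def(A) ∧ ⋀_{A' ∈ H(r)∖Δ} ¬Φ(A')`. -/
noncomputable def LCRule.psi {X A : Type} (r : LCRule X A) (Δ : Finset (Fin r.hn)) : LFml X A :=
  (bigAnd ([r.bodyFml] ++
           Δ.toList.map (fun i => (r.head i).defF) ++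
           Δᶜ.toList.map (fun i => Fml.neg (r.head i).phi))).imp
  (bigOr (Δ.toList.map (fun i => (r.head i).phi)))

/-- `⟨h,t⟩` is a model of a theory `Γ`. -/
def SatTheoryL {X D A : Type} (I : IntDom D) (den : A → Set (Val X D))
    (h t : Val X D) (Γ : Set (LFml X A)) : Prop :=
  ∀ φ ∈ Γ, SatL I den h t φ

/-- `t` is a stable model of the theory `Γ`: `⟨t,t⟩ ⊨ Γ` and there is no `h ⊊ t`
    with `⟨h,t⟩ ⊨ Γ`. -/
def StableL {X D A : Type} (I : IntDom D) (den : A → Set (Val X D))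
    (Γ : Set (LFml X A)) (t : Val X D) : Prop :=
  SatTheoryL I den t t Γ ∧
  ∀ h : Val X D, Val.le h t → h ≠ t → ¬ SatTheoryL I den h t Γ

/-- Evaluation `v(τ)` of a conditional linear term in the total interpretation
    `⟨v,v⟩`. -/
noncomputable def CLTerm.evalTot {X D A : Type} (I : IntDom D)
    (den : A → Set (Val X D)) (v : Val X D) (τ : CLTerm X A) : Option ℤ :=
  (τ.reduce I den v v).eval I v

/-- Value `d ∈ 𝒟` is supported for variable `x` wrt LC-program `Pgm` and
    valuation `v`:  there are a rule `r ∈ Pgm` and an assignment `x := α..β` in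
    the head of `r` such that
    (1) `v(x) = d` and `v(α) ≤ d ≤ v(β)`, so both `v(α), v(β) ∈ ℤ`;
    (2) `v ⊭ A'` for every assignment `A' = (y := α'..β')` in the head of `r`
        where `y` is a variable different from `x`;
    (3) `v ⊨ B(r)`. -/
def SupportedValue {X D A : Type} (I : IntDom D) (den : A → Set (Val X D))
    (Pgm : Set (LCRule X A)) (v : Val X D) (x : X) (d : D) : Prop :=
  ∃ r ∈ Pgm, ∃ i : Fin r.hn,
    (r.head i).x = x ∧
    (∃ m a b : ℤ, d = I.emb m ∧ v x = some d ∧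
       (r.head i).lo.evalTot I den v = some a ∧
       (r.head i).hi.evalTot I den v = some b ∧ a ≤ m ∧ m ≤ b) ∧
    (∀ j : Fin r.hn, (r.head j).x ≠ x → ¬ SatL I den v v (r.head j).fml) ∧
    SatL I den v v r.bodyFml

end HTC

namespace HTC

theorem ueval_mono {X D : Type} (I : IntDom D) {h t : Val X D} (hle : Val.le h t)
    (τ : UTerm X) : ∀ n, τ.eval I h = some n → τ.eval I t = some n := by
  induction τ with
  | const k => intro n hn; exact hn
  | var x =>
    intro n hn
    simp only [UTerm.eval, Option.bind_eq_some_iff] at hn ⊢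
    obtain ⟨d, hd, hn⟩ := hn
    exact ⟨d, hle x d hd, hn⟩
  | undef => intro n hn; exact hn
  | add a b iha ihb =>
    intro n hn
    simp only [UTerm.eval, Option.bind_eq_some_iff, Option.map_eq_some_iff] at hn ⊢
    obtain ⟨p, hp, q, hq, e⟩ := hn
    exact ⟨p, iha _ hp, q, ihb _ hq, e⟩
  | sub a b iha ihb =>
    intro n hn
    simp only [UTerm.eval, Option.bind_eq_some_iff, Option.map_eq_some_iff] at hn ⊢
    obtain ⟨p, hp, q, hq, e⟩ := hn
    exact ⟨p, iha _ hp, q, ihb _ hq, e⟩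

theorem satCF_mono {X D A : Type} (I : IntDom D) (den : A → Set (Val X D))
    (h1 : Mono den) {h t : Val X D} (hle : Val.le h t) (φ : CFml X A) :
    SatCF I den h t φ → SatCF I den t t φ := by
  induction φ with
  | bot => exact id
  | atom a =>
    cases a with
    | inl a => exact fun H => h1 a h t H hle
    | inr p =>
      rintro ⟨m, n, hm, hn, hmn⟩
      exact ⟨m, n, ueval_mono I hle _ _ hm, ueval_mono I hle _ _ hn, hmn⟩
  | and φ ψ i j => exact fun H => ⟨i H.1, j H.2⟩
  | or φ ψ i j => exact fun H => H.imp i j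
  | imp φ ψ i j => exact fun H => ⟨H.2, H.2⟩

theorem reduce_mono {X D A : Type} (I : IntDom D) (den : A → Set (Val X D))
    (h1 : Mono den) {h t : Val X D} (hle : Val.le h t) (τ : CLTerm X A) :
    ∀ n, (τ.reduce I den h t).eval I h = some n → (τ.reduce I den t t).eval I t = some n := by
  induction τ with
  | const k => intro n hn; exact hn
  | var x => exact ueval_mono I hle (.var x)
  | add a b iha ihb =>
    intro n hn
    simp only [CLTerm.reduce, UTerm.eval, Option.bind_eq_some_iff,
      Option.map_eq_some_iff] at hn ⊢
    obtain ⟨p, hp, q, hq, e⟩ := hn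
    exact ⟨p, iha _ hp, q, ihb _ hq, e⟩
  | sub a b iha ihb =>
    intro n hn
    simp only [CLTerm.reduce, UTerm.eval, Option.bind_eq_some_iff,
      Option.map_eq_some_iff] at hn ⊢
    obtain ⟨p, hp, q, hq, e⟩ := hn
    exact ⟨p, iha _ hp, q, ihb _ hq, e⟩
  | cond s s' φ =>
    intro n hn
    have key := satCF_mono I den h1 hle φ
    by_cases a : SatCF I den h t φ
    · have b := key a
      simp only [CLTerm.reduce, if_pos a, if_pos b] at hn ⊢
      exact ueval_mono I hle _ _ hn
    · by_cases b : SatCF I den t t φ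
      · simp [CLTerm.reduce, a, b, UTerm.eval] at hn
      · simp only [CLTerm.reduce, a, b, if_false, not_false_eq_true, if_true] at hn ⊢
        exact ueval_mono I hle _ _ hn

theorem satL_mono {X D A : Type} (I : IntDom D) (den : A → Set (Val X D))
    (h1 : Mono den) {h t : Val X D} (hle : Val.le h t) (φ : LFml X A) :
    SatL I den h t φ → SatL I den t t φ := by
  induction φ with
  | bot => exact id
  | atom a =>
    cases a with
    | inl a => exact fun H => h1 a h t H hle
    | inr p =>
      rintro ⟨m, n, hm, hn, hmn⟩
      exact ⟨m, n, reduce_mono I den h1 hle _ _ hm, reduce_mono I den h1 hle _ _ hn, hmn⟩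
  | and φ ψ i j => exact fun H => ⟨i H.1, j H.2⟩
  | or φ ψ i j => exact fun H => H.imp i j
  | imp φ ψ i j => exact fun H => ⟨H.2, H.2⟩

theorem sat_bigAnd {X D A : Type} (I : IntDom D) (den : A → Set (Val X D))
    (h t : Val X D) (l : List (LFml X A)) :
    SatL I den h t (bigAnd l) ↔ ∀ φ ∈ l, SatL I den h t φ := by
  induction l with
  | nil => simp [bigAnd, Fml.top, Fml.neg, SatL]
  | cons a l ih =>
    rw [List.forall_mem_cons, ← ih]
    exact Iff.rfl

theorem sat_bigOr {X D A : Type} (I : IntDom D) (den : A → Set (Val X D))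
    (h t : Val X D) (l : List (LFml X A)) :
    SatL I den h t (bigOr l) ↔ ∃ φ ∈ l, SatL I den h t φ := by
  induction l with
  | nil => simp [bigOr, SatL]
  | cons a l ih =>
    rw [List.exists_mem_cons_iff, ← ih]
    exact Iff.rfl

theorem phi_def {X D A : Type} (I : IntDom D) (den : A → Set (Val X D))
    (h t : Val X D) (a : Assign X A) :
    SatL I den h t a.phi → SatL I den h t a.defF := by
  rintro ⟨⟨m, n, hm, hn, hmn⟩, ⟨m', n', hm', hn', hmn'⟩⟩
  exact ⟨⟨m, m, hm, hm, le_refl _⟩, ⟨n', n', hn', hn', le_refl _⟩⟩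

theorem sat_neg {X D A : Type} (I : IntDom D) (den : A → Set (Val X D))
    (h1 : Mono den) {h t : Val X D} (hle : Val.le h t) (φ : LFml X A) :
    SatL I den h t φ.neg ↔ ¬ SatL I den t t φ :=
  ⟨fun H => H.2, fun H => ⟨fun K => H (satL_mono I den h1 hle φ K), H⟩⟩

theorem sat_assign {X D A : Type} (I : IntDom D) (den : A → Set (Val X D))
    (h1 : Mono den) {h t : Val X D} (hle : Val.le h t) (a : Assign X A) :
    SatL I den h t a.fml ↔
      SatL I den t t a.phi ∧ (SatL I den h t a.defF → SatL I den h t a.phi) := by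
  have hr : Val.le t t := fun _ _ H => H
  have e : SatL I den h t a.fml ↔ SatL I den h t a.defF.neg.neg ∧
      ((SatL I den h t a.defF → SatL I den h t a.phi) ∧
       (SatL I den t t a.defF → SatL I den t t a.phi)) := Iff.rfl
  rw [e, sat_neg I den h1 hle, sat_neg I den h1 hr]
  have := phi_def I den t t a
  tauto

theorem sat_psi_ant {X D A : Type} (I : IntDom D) (den : A → Set (Val X D))
    (h1 : Mono den) {h t : Val X D} (hle : Val.le h t) (r : LCRule X A)
    (Δ : Finset (Fin r.hn)) :
    SatL I den h t (bigAnd ([r.bodyFml] ++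
           Δ.toList.map (fun i => (r.head i).defF) ++
           Δᶜ.toList.map (fun i => Fml.neg (r.head i).phi))) ↔
      SatL I den h t r.bodyFml ∧ (∀ i ∈ Δ, SatL I den h t (r.head i).defF) ∧
        ∀ i, i ∉ Δ → ¬ SatL I den t t (r.head i).phi := by
  rw [sat_bigAnd, List.forall_mem_append, List.forall_mem_append]
  simp [sat_neg I den h1 hle, and_assoc]

theorem sat_psi {X D A : Type} (I : IntDom D) (den : A → Set (Val X D))
    (h1 : Mono den) {h t : Val X D} (hle : Val.le h t) (r : LCRule X A)
    (Δ : Finset (Fin r.hn)) :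
    SatL I den h t (r.psi Δ) ↔
      ((SatL I den h t r.bodyFml ∧ (∀ i ∈ Δ, SatL I den h t (r.head i).defF) ∧
        ∀ i, i ∉ Δ → ¬ SatL I den t t (r.head i).phi) →
          ∃ i ∈ Δ, SatL I den h t (r.head i).phi) ∧
      ((SatL I den t t r.bodyFml ∧ (∀ i ∈ Δ, SatL I den t t (r.head i).defF) ∧
        ∀ i, i ∉ Δ → ¬ SatL I den t t (r.head i).phi) →
          ∃ i ∈ Δ, SatL I den t t (r.head i).phi) := by
  have hr : Val.le t t := fun _ _ H => H
  rw [← sat_psi_ant I den h1 hle, ← sat_psi_ant I den h1 hr]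
  simp only [LCRule.psi, SatL, sat_bigOr]
  simp

theorem sat_rule {X D A : Type} (I : IntDom D) (den : A → Set (Val X D))
    (h1 : Mono den) {h t : Val X D} (hle : Val.le h t) (r : LCRule X A) :
    SatL I den h t r.fml ↔
      (SatL I den h t r.bodyFml → ∃ i, SatL I den t t (r.head i).phi ∧
        (SatL I den h t (r.head i).defF → SatL I den h t (r.head i).phi)) ∧
      (SatL I den t t r.bodyFml → ∃ i, SatL I den t t (r.head i).phi) := by
  have hr : Val.le t t := fun _ _ H => H
  simp only [LCRule.fml, SatL, sat_bigOr, List.mem_map, List.mem_finRange, true_and,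
    exists_exists_eq_and, sat_assign I den h1 hle, sat_assign I den h1 hr]
  refine and_congr Iff.rfl (imp_congr Iff.rfl (exists_congr fun i => ?_))
  tauto

/-- Theorem 1: unfolding of LC-rules: an LC-rule
    `r = (A₁ ; … ; Aₙ ← B₁, …, B_m, ¬B_{m+1}, …, ¬B_k)` has the same HT_C models
    as the conjunction, over all subsets `Δ ⊆ H(r)`, of the implications `Ψ_Δ`. -/
theorem lc_rule_unfolding {X D A : Type} (I : IntDom D) (den : A → Set (Val X D))
    (h1 : Mono den) (r : LCRule X A) :
    ∀ (h t : Val X D), Val.le h t →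
      (SatL I den h t r.fml ↔ ∀ Δ : Finset (Fin r.hn), SatL I den h t (r.psi Δ)) := by
  classical
  intro h t hle
  rw [sat_rule I den h1 hle]
  simp only [sat_psi I den h1 hle]
  constructor
  · rintro ⟨H1, H2⟩ Δ
    constructor
    · rintro ⟨hb, hd, hp⟩
      obtain ⟨i, hi, hi'⟩ := H1 hb
      have hm : i ∈ Δ := by
        by_contra hm
        exact hp i hm hi
      exact ⟨i, hm, hi' (hd i hm)⟩
    · rintro ⟨hb, hd, hp⟩
      obtain ⟨i, hi⟩ := H2 hb
      refine ⟨i, ?_, hi⟩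
      by_contra hm
      exact hp i hm hi
  · intro H
    obtain ⟨H1, H2⟩ := H (Finset.univ.filter fun i => SatL I den t t (r.head i).phi)
    simp only [Finset.mem_filter, Finset.mem_univ, true_and] at H1 H2
    constructor
    · intro hb
      by_contra hc
      push Not at hc
      obtain ⟨i, hi, hp⟩ := H1 ⟨hb, fun i hi => (hc i hi).1, fun i hi => hi⟩
      exact (hc i hi).2 hp
    · intro hb
      obtain ⟨i, hi, -⟩ := H2 ⟨hb, fun i hi => phi_def I den t t _ hi, fun i hi => hi⟩
      exact ⟨i, hi⟩

end HTC
end
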